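/- arXiv:math/0606781 — 2 statements merged into one kernel-verified Lean document; each statement's English description precedes it below -/
import Mathlib

section
/- Let 0 < q < 1 be a real number, let u be a nonzero complex number, and let λ ∈ [0,1) be a real number. Then there exists a positive integer M such that for every integer m ≥ M, (−q^{−(m+λ)+1/2} u; q)_∞ = u^m · ( θ(u^{−1} q^{λ}; q) + r_m ) / ( (q;q)_∞ · q^{m²/2 + mλ} ), where the error term satisfies |r_m| ≤ (3·(−q;q)_∞ · θ(|u|^{−1} q^{λ}; q) / (1−q)) · ( q^{m/2} + q^{m²/8} / |u|^{⌊m/2⌋+1} ), and powers of q with real exponents denote real powers. -/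
/-- The infinite q-Pochhammer symbol `(a;q)_∞ = ∏_{j=0}^∞ (1 - a qʲ)`. -/
noncomputable def qPochInf (a : ℂ) (q : ℝ) : ℂ := ∏' j : ℕ, (1 - a * (q : ℂ) ^ j)

/-- The real infinite q-Pochhammer symbol `(a;q)_∞ = ∏_{j=0}^∞ (1 - a qʲ)`. -/
noncomputable def qPochInfR (a q : ℝ) : ℝ := ∏' j : ℕ, (1 - a * q ^ j)

/-- The theta function `θ(z;q) = Σ_{k=-∞}^∞ q^{k²/2} zᵏ` for complex `z ≠ 0`. -/
noncomputable def theta (z : ℂ) (q : ℝ) : ℂ :=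
  ∑' k : ℤ, ((q ^ ((k : ℝ) ^ 2 / 2) : ℝ) : ℂ) * z ^ k

/-- The real theta function `θ(x;q) = Σ_{k=-∞}^∞ q^{k²/2} xᵏ`. -/
noncomputable def thetaR (x q : ℝ) : ℝ := ∑' k : ℤ, q ^ ((k : ℝ) ^ 2 / 2) * x ^ k

/-- The tail `(q^{n+1};q)_∞` of Euler's product. -/
noncomputable def qTail (q : ℝ) (n : ℕ) : ℝ := ∏' j : ℕ, (1 - q ^ (n + 1 + j))

/-- The tail `(q^{n+1};q)_∞` indexed by all integers; it vanishes for `n < 0`. -/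
noncomputable def qTailInt (q : ℝ) (n : ℤ) : ℝ := if 0 ≤ n then qTail q n.toNat else 0

/-- The weighted Euler series `Σ_k q^{k²/2} (q^{k+1};q)_∞ yᵏ`. -/
noncomputable def eulerSeries (q : ℝ) (y : ℂ) : ℂ :=
  ∑' k : ℕ, ((q ^ ((k : ℝ) ^ 2 / 2) * qTail q k : ℝ) : ℂ) * y ^ k

section

variable {q : ℝ}

lemma multipliable_qTail (hq0 : 0 < q) (hq1 : q < 1) (n : ℕ) :
    Multipliable fun j : ℕ => 1 - q ^ (n + 1 + j) := by
  simp_rw [sub_eq_add_neg]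
  apply Real.multipliable_one_add_of_summable
  simp_rw [pow_add q (n + 1)]
  exact ((summable_geometric_of_lt_one hq0.le hq1).mul_left _).neg

lemma qTail_succ (hq0 : 0 < q) (hq1 : q < 1) (n : ℕ) :
    qTail q n = (1 - q ^ (n + 1)) * qTail q (n + 1) := by
  have h := multipliable_qTail hq0 hq1 (n + 1)
  have e : ∀ j : ℕ, n + 1 + 1 + j = n + 1 + (j + 1) := fun j => by omega
  simp_rw [qTail, e] at h ⊢
  rw [tprod_eq_zero_mul' (f := fun j => 1 - q ^ (n + 1 + j)) h, add_zero]

lemma tendsto_qTail (hq0 : 0 < q) (hq1 : q < 1) (n : ℕ) :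
    Filter.Tendsto (fun N => ∏ j ∈ Finset.range N, (1 - q ^ (n + 1 + j))) Filter.atTop
      (nhds (qTail q n)) :=
  (multipliable_qTail hq0 hq1 n).tendsto_prod_tprod_nat

lemma one_sub_pow_nonneg (hq0 : 0 < q) (hq1 : q < 1) (k : ℕ) : 0 ≤ 1 - q ^ k :=
  sub_nonneg.2 (pow_le_one₀ hq0.le hq1.le)

lemma qTail_nonneg (hq0 : 0 < q) (hq1 : q < 1) (n : ℕ) : 0 ≤ qTail q n :=
  ge_of_tendsto' (tendsto_qTail hq0 hq1 n) fun _ =>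
    Finset.prod_nonneg fun _ _ => one_sub_pow_nonneg hq0 hq1 _

lemma qTail_le_one (hq0 : 0 < q) (hq1 : q < 1) (n : ℕ) : qTail q n ≤ 1 :=
  le_of_tendsto' (tendsto_qTail hq0 hq1 n) fun _ =>
    Finset.prod_le_one (fun _ _ => one_sub_pow_nonneg hq0 hq1 _)
      fun _ _ => sub_le_self _ (pow_nonneg hq0.le _)

lemma one_sub_geom_le_prod (hq0 : 0 < q) (hq1 : q < 1) (n N : ℕ) :
    1 - (q ^ (n + 1) - q ^ (n + 1 + N)) / (1 - q) ≤
      ∏ j ∈ Finset.range N, (1 - q ^ (n + 1 + j)) := by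
  have h1 : 0 < 1 - q := by linarith
  induction N with
  | zero => simp
  | succ N ih =>
    rw [Finset.prod_range_succ]
    have hle : ∏ j ∈ Finset.range N, (1 - q ^ (n + 1 + j)) ≤ 1 :=
      Finset.prod_le_one (fun _ _ => one_sub_pow_nonneg hq0 hq1 _)
        fun _ _ => sub_le_self _ (pow_nonneg hq0.le _)
    have hp : 0 < q ^ (n + 1 + N) := pow_pos hq0 _
    have e : (q ^ (n + 1) - q ^ (n + 1 + (N + 1))) / (1 - q) =
        (q ^ (n + 1) - q ^ (n + 1 + N)) / (1 - q) + q ^ (n + 1 + N) := by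
      field_simp
      ring
    rw [e]
    nlinarith

lemma one_sub_qTail_le (hq0 : 0 < q) (hq1 : q < 1) (n : ℕ) :
    1 - qTail q n ≤ q ^ (n + 1) / (1 - q) := by
  have h1 : 0 < 1 - q := by linarith
  have : 1 - q ^ (n + 1) / (1 - q) ≤ qTail q n := by
    refine ge_of_tendsto' (tendsto_qTail hq0 hq1 n) fun N => le_trans ?_
      (one_sub_geom_le_prod hq0 hq1 n N)
    have : 0 < q ^ (n + 1 + N) := pow_pos hq0 _
    gcongr
    linarith
  linarith

lemma qTail_zero_ne_zero (hq0 : 0 < q) (hq1 : q < 1) : qTail q 0 ≠ 0 := by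
  have key : ∀ n, qTail q 0 = 0 → qTail q n = 0 := by
    intro n h
    induction n with
    | zero => exact h
    | succ n ih =>
      rw [qTail_succ hq0 hq1] at ih
      refine (mul_eq_zero.1 ih).resolve_left ?_
      have := pow_lt_one₀ hq0.le hq1 (Nat.succ_ne_zero n)
      exact (sub_pos.2 this).ne'
  intro h
  have hlim : Filter.Tendsto (fun n : ℕ => q ^ n / (1 - q)) Filter.atTop (nhds 0) := by
    simpa using (tendsto_pow_atTop_nhds_zero_of_lt_one hq0.le hq1).div_const (1 - q)
  obtain ⟨n, hn⟩ := (((Filter.tendsto_add_atTop_iff_nat 1).2 hlim).eventually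
    (gt_mem_nhds one_pos)).exists
  have := one_sub_qTail_le hq0 hq1 n
  rw [key n h] at this
  linarith

lemma qPochInfR_self : qPochInfR q q = qTail q 0 := by
  simp only [qPochInfR, qTail]
  exact tprod_congr fun j => by ring

lemma summable_nat_theta (hq0 : 0 < q) (hq1 : q < 1) {x : ℝ} (hx : 0 < x) :
    Summable fun k : ℕ => q ^ ((k : ℝ) ^ 2 / 2) * x ^ k := by
  refine summable_of_ratio_test_tendsto_lt_one zero_lt_one
    (Filter.Eventually.of_forall fun n => by positivity) ?_
  have e : ∀ n : ℕ, ‖q ^ (((n + 1 : ℕ) : ℝ) ^ 2 / 2) * x ^ (n + 1)‖ /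
      ‖q ^ ((n : ℝ) ^ 2 / 2) * x ^ n‖ = q ^ n * (q ^ (1 / 2 : ℝ) * x) := by
    intro n
    rw [Real.norm_of_nonneg (by positivity), Real.norm_of_nonneg (by positivity),
      div_eq_iff (by positivity)]
    have : ((n + 1 : ℕ) : ℝ) ^ 2 / 2 = n + 1 / 2 + (n : ℝ) ^ 2 / 2 := by push_cast; ring
    rw [this, Real.rpow_add hq0, Real.rpow_add hq0, Real.rpow_natCast]
    ring
  simp_rw [e]
  simpa using (tendsto_pow_atTop_nhds_zero_of_lt_one hq0.le hq1).mul_const (q ^ (1 / 2 : ℝ) * x)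

lemma summable_thetaR (hq0 : 0 < q) (hq1 : q < 1) {x : ℝ} (hx : 0 < x) :
    Summable fun k : ℤ => q ^ ((k : ℝ) ^ 2 / 2) * x ^ k := by
  refine Summable.of_nat_of_neg ?_ ?_
  · simpa using summable_nat_theta hq0 hq1 hx
  · simpa using summable_nat_theta hq0 hq1 (inv_pos.2 hx)

lemma norm_eulerSeries_term_le (hq0 : 0 < q) (hq1 : q < 1) (y : ℂ) (k : ℕ) :
    ‖((q ^ ((k : ℝ) ^ 2 / 2) * qTail q k : ℝ) : ℂ) * y ^ k‖ ≤
      q ^ ((k : ℝ) ^ 2 / 2) * (‖y‖ + 1) ^ k := by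
  have h0 := qTail_nonneg hq0 hq1 k
  rw [norm_mul, Complex.norm_real, Real.norm_of_nonneg (by positivity), norm_pow]
  gcongr
  · exact mul_le_of_le_one_right (by positivity) (qTail_le_one hq0 hq1 k)
  · linarith

lemma summable_eulerSeries (hq0 : 0 < q) (hq1 : q < 1) (y : ℂ) :
    Summable fun k : ℕ => ((q ^ ((k : ℝ) ^ 2 / 2) * qTail q k : ℝ) : ℂ) * y ^ k :=
  Summable.of_norm_bounded (summable_nat_theta hq0 hq1 (by positivity))
    (norm_eulerSeries_term_le hq0 hq1 y)

lemma eulerSeries_functional (hq0 : 0 < q) (hq1 : q < 1) (y : ℂ) :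
    eulerSeries q y = (1 + ((q ^ (1 / 2 : ℝ) : ℝ) : ℂ) * y) * eulerSeries q (q * y) := by
  have hs := summable_eulerSeries hq0 hq1 y
  have hs' := summable_eulerSeries hq0 hq1 (q * y)
  have hd := (hs.sub hs').tsum_eq_zero_add
  rw [hs.tsum_sub hs'] at hd
  have key : ∀ k : ℕ,
      ((q ^ (((k + 1 : ℕ) : ℝ) ^ 2 / 2) * qTail q (k + 1) : ℝ) : ℂ) * y ^ (k + 1) -
        ((q ^ (((k + 1 : ℕ) : ℝ) ^ 2 / 2) * qTail q (k + 1) : ℝ) : ℂ) * (q * y) ^ (k + 1) =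
      ((q ^ (1 / 2 : ℝ) : ℝ) : ℂ) * y *
        (((q ^ ((k : ℝ) ^ 2 / 2) * qTail q k : ℝ) : ℂ) * (q * y) ^ k) := by
    intro k
    have : ((k + 1 : ℕ) : ℝ) ^ 2 / 2 = k + 1 / 2 + (k : ℝ) ^ 2 / 2 := by push_cast; ring
    rw [this, Real.rpow_add hq0, Real.rpow_add hq0, Real.rpow_natCast, qTail_succ hq0 hq1 k]
    push_cast
    ring
  simp_rw [key, tsum_mul_left] at hd
  simp only [pow_zero, sub_self, zero_add] at hd
  change eulerSeries q y - eulerSeries q (q * y) = _ * eulerSeries q (q * y) at hd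
  linear_combination hd

lemma eulerSeries_eq_prod_mul (hq0 : 0 < q) (hq1 : q < 1) (y : ℂ) (N : ℕ) :
    eulerSeries q y = (∏ j ∈ Finset.range N, (1 + ((q ^ (1 / 2 : ℝ) : ℝ) : ℂ) * y * q ^ j)) *
      eulerSeries q (q ^ N * y) := by
  induction N with
  | zero => simp
  | succ N ih =>
    rw [ih, Finset.prod_range_succ, eulerSeries_functional hq0 hq1 (q ^ N * y), pow_succ']
    ring_nf

lemma tendsto_eulerSeries (hq0 : 0 < q) (hq1 : q < 1) (y : ℂ) :
    Filter.Tendsto (fun N : ℕ => eulerSeries q (q ^ N * y)) Filter.atTop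
      (nhds (qTail q 0 : ℂ)) := by
  have hz : eulerSeries q 0 = (qTail q 0 : ℂ) := by
    rw [eulerSeries, tsum_eq_single 0]
    · simp
    · intro k hk
      simp [hk]
  rw [← hz]
  have hqN : Filter.Tendsto (fun N : ℕ => (q : ℂ) ^ N * y) Filter.atTop (nhds 0) := by
    simpa using (tendsto_pow_atTop_nhds_zero_of_norm_lt_one (x := (q : ℂ))
      (by simpa [abs_of_pos hq0] using hq1)).mul_const y
  refine tendsto_tsum_of_dominated_convergence
    (bound := fun k : ℕ => q ^ ((k : ℝ) ^ 2 / 2) * (‖y‖ + 1) ^ k)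
    (summable_nat_theta hq0 hq1 (by positivity)) (fun k => (hqN.pow k).const_mul _)
    (Filter.Eventually.of_forall fun N k => (norm_eulerSeries_term_le hq0 hq1 _ k).trans ?_)
  gcongr
  rw [norm_mul, norm_pow, Complex.norm_real, Real.norm_of_nonneg hq0.le]
  exact mul_le_of_le_one_left (norm_nonneg _) (pow_le_one₀ hq0.le hq1.le)

/-- Euler's expansion of `(-q^{1/2} y;q)_∞`. -/
lemma qPochInf_mul_qTail (hq0 : 0 < q) (hq1 : q < 1) (y : ℂ) :
    qPochInf (-(((q ^ (1 / 2 : ℝ) : ℝ) : ℂ) * y)) q * qTail q 0 = eulerSeries q y := by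
  have hm : Multipliable fun j : ℕ => 1 + ((q ^ (1 / 2 : ℝ) : ℝ) : ℂ) * y * (q : ℂ) ^ j := by
    apply multipliable_one_add_of_summable
    simp_rw [norm_mul, norm_pow, Complex.norm_real, Real.norm_of_nonneg hq0.le]
    exact (summable_geometric_of_lt_one hq0.le hq1).mul_left _
  have e : qPochInf (-(((q ^ (1 / 2 : ℝ) : ℝ) : ℂ) * y)) q =
      ∏' j : ℕ, (1 + ((q ^ (1 / 2 : ℝ) : ℝ) : ℂ) * y * (q : ℂ) ^ j) :=
    tprod_congr fun j => by ring
  rw [e]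
  refine tendsto_nhds_unique (hm.tendsto_prod_tprod_nat.mul (tendsto_eulerSeries hq0 hq1 y)) ?_
  simp_rw [← eulerSeries_eq_prod_mul hq0 hq1 y]
  exact tendsto_const_nhds

lemma qTailInt_nonneg (hq0 : 0 < q) (hq1 : q < 1) (n : ℤ) : 0 ≤ qTailInt q n := by
  unfold qTailInt
  split_ifs
  · exact qTail_nonneg hq0 hq1 _
  · exact le_rfl

lemma qTailInt_le_one (hq0 : 0 < q) (hq1 : q < 1) (n : ℤ) : qTailInt q n ≤ 1 := by
  unfold qTailInt
  split_ifs
  · exact qTail_le_one hq0 hq1 _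
  · exact zero_le_one

lemma one_sub_qTailInt_le (hq0 : 0 < q) (hq1 : q < 1) {n : ℤ} (hn : 0 ≤ n) {s : ℝ}
    (hs : s ≤ n) : 1 - qTailInt q n ≤ q ^ s / (1 - q) := by
  have h1 : 0 < 1 - q := by linarith
  lift n to ℕ using hn
  simp only [qTailInt, Int.natCast_nonneg, if_true, Int.toNat_natCast]
  refine (one_sub_qTail_le hq0 hq1 n).trans ?_
  gcongr
  rw [← Real.rpow_natCast]
  refine Real.rpow_le_rpow_of_exponent_ge hq0 hq1.le (hs.trans ?_)
  push_cast
  linarith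

/-- Completing the square in Euler's expansion at `y = q^{-(m+λ)} u`. -/
lemma eulerSeries_eq_tsum_int (hq0 : 0 < q) {u : ℂ} (hu : u ≠ 0) (lam : ℝ) (m : ℕ) :
    eulerSeries q (((q ^ (-((m : ℝ) + lam)) : ℝ) : ℂ) * u) *
        ((q ^ ((m : ℝ) ^ 2 / 2 + m * lam) : ℝ) : ℂ) =
      u ^ m * ∑' j : ℤ, ((q ^ ((j : ℝ) ^ 2 / 2) : ℝ) : ℂ) *
        (u⁻¹ * ((q ^ lam : ℝ) : ℂ)) ^ j * (qTailInt q (m - j) : ℂ) := by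
  have hinj : Function.Injective fun k : ℕ => (m : ℤ) - k := fun a b h => by
    simp only at h
    omega
  rw [← hinj.tsum_eq, eulerSeries, ← tsum_mul_right, ← tsum_mul_left]
  · refine tsum_congr fun k => ?_
    have e1 : qTailInt q ((m : ℤ) - (m - k)) = qTail q k := by simp [qTailInt]
    have e2 : (u⁻¹ * ((q ^ lam : ℝ) : ℂ)) ^ ((m : ℤ) - k) =
        (u ^ m)⁻¹ * u ^ k * ((q ^ (lam * (m - k)) : ℝ) : ℂ) := by
      rw [mul_zpow, inv_zpow', neg_sub, zpow_sub₀ hu, Real.rpow_mul hq0.le, div_eq_inv_mul]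
      have : ((m : ℝ) - k) = (((m : ℤ) - k : ℤ) : ℝ) := by push_cast; ring
      rw [this, Real.rpow_intCast]
      push_cast
      simp
    have e3 : q ^ ((k : ℝ) ^ 2 / 2) * (q ^ (-((m : ℝ) + lam))) ^ k *
          q ^ ((m : ℝ) ^ 2 / 2 + m * lam) =
        q ^ ((((m : ℤ) - k : ℤ) : ℝ) ^ 2 / 2) * q ^ (lam * (m - k)) := by
      rw [← Real.rpow_natCast (q ^ _), ← Real.rpow_mul hq0.le, ← Real.rpow_add hq0,
        ← Real.rpow_add hq0, ← Real.rpow_add hq0]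
      congr 1
      push_cast
      ring
    have e3' := congrArg (fun x : ℝ => (x : ℂ)) e3
    simp only [Complex.ofReal_mul, Complex.ofReal_pow] at e3'
    simp only [e1, e2, Complex.ofReal_mul, mul_pow]
    have hum : u ^ m * (u ^ m)⁻¹ = 1 := mul_inv_cancel₀ (pow_ne_zero _ hu)
    linear_combination (qTail q k : ℂ) * u ^ k * e3' -
      ((q ^ ((((m : ℤ) - k : ℤ) : ℝ) ^ 2 / 2) : ℝ) : ℂ) * ((q ^ (lam * (m - k)) : ℝ) : ℂ) *
        (qTail q k : ℂ) * u ^ k * hum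
  · intro j hj
    have : 0 ≤ (m : ℤ) - j := by
      by_contra h
      exact hj (by simp only [qTailInt, if_neg h, Complex.ofReal_zero, mul_zero])
    exact ⟨((m : ℤ) - j).toNat, by simp only; omega⟩

lemma theta_term_le_shift (hq0 : 0 < q) (hq1 : q < 1) {x : ℝ} (hx : 0 < x) (h : ℕ) {j : ℤ}
    (hj : h ≤ j) :
    q ^ ((j : ℝ) ^ 2 / 2) * x ^ j ≤
      q ^ ((h : ℝ) ^ 2 / 2) * x ^ h * (q ^ (((j - h : ℤ) : ℝ) ^ 2 / 2) * x ^ (j - h)) := by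
  have hj' : (h : ℝ) ≤ j := by exact_mod_cast hj
  rw [zpow_sub₀ hx.ne', zpow_natCast]
  have : q ^ ((h : ℝ) ^ 2 / 2) * x ^ h * (q ^ (((j - h : ℤ) : ℝ) ^ 2 / 2) * (x ^ j / x ^ h)) =
      q ^ ((h : ℝ) ^ 2 / 2 + ((j - h : ℤ) : ℝ) ^ 2 / 2) * x ^ j := by
    rw [Real.rpow_add hq0]
    field_simp
  rw [this]
  have hxj : 0 < x ^ j := zpow_pos hx _
  gcongr ?_ * _
  refine Real.rpow_le_rpow_of_exponent_ge hq0 hq1.le ?_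
  push_cast
  nlinarith [mul_nonneg (Nat.cast_nonneg (α := ℝ) h) (sub_nonneg.2 hj')]

lemma one_le_tprod_one_add_pow (hq0 : 0 < q) (hq1 : q < 1) :
    1 ≤ ∏' j : ℕ, (1 + q ^ (j + 1)) := by
  have hm : Multipliable fun j : ℕ => 1 + q ^ (j + 1) :=
    Real.multipliable_one_add_of_summable
      ((summable_nat_add_iff 1).2 (summable_geometric_of_lt_one hq0.le hq1))
  exact ge_of_tendsto' hm.tendsto_prod_tprod_nat fun N => Finset.one_le_prod fun j _ =>
    le_add_of_nonneg_right (pow_nonneg hq0.le _)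

end

/-- Rational case of the main theorem: for `0 < q < 1`, nonzero complex `u` and `λ ∈ [0,1)`,
there is `M ≥ 1` such that for all `m ≥ M`,
`(-q^{-(m+λ)+1/2} u; q)_∞ = u^m (θ(u⁻¹ q^λ;q) + r_m) / ((q;q)_∞ q^{m²/2+mλ})` with
`|r_m| ≤ (3 (-q;q)_∞ θ(|u|⁻¹ q^λ;q)/(1-q)) (q^{m/2} + q^{m²/8}/|u|^{⌊m/2⌋+1})`. -/
theorem main_rational_case (q : ℝ) (hq0 : 0 < q) (hq1 : q < 1) (u : ℂ) (hu : u ≠ 0)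
    (lam : ℝ) (hlam : lam ∈ Set.Ico (0 : ℝ) 1) :
    ∃ M : ℕ, 0 < M ∧ ∀ m : ℕ, M ≤ m → ∃ r : ℂ,
      qPochInf (-(((q ^ (-((m : ℝ) + lam) + 1 / 2) : ℝ) : ℂ) * u)) q =
        u ^ m * (theta (u⁻¹ * ((q ^ lam : ℝ) : ℂ)) q + r) /
          (((qPochInfR q q : ℝ) : ℂ) * ((q ^ ((m : ℝ) ^ 2 / 2 + m * lam) : ℝ) : ℂ)) ∧
      ‖r‖ ≤ 3 * (∏' j : ℕ, (1 + q ^ (j + 1))) * thetaR (‖u‖⁻¹ * q ^ lam) q / (1 - q) *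
        (q ^ ((m : ℝ) / 2) + q ^ ((m : ℝ) ^ 2 / 8) / ‖u‖ ^ (m / 2 + 1)) := by
  have h1 : 0 < 1 - q := by linarith
  refine ⟨1, one_pos, fun m _ => ?_⟩
  set w : ℂ := u⁻¹ * ((q ^ lam : ℝ) : ℂ) with hw
  have hu' : 0 < ‖u‖ := norm_pos_iff.2 hu
  set x : ℝ := ‖u‖⁻¹ * q ^ lam with hx
  have hx0 : 0 < x := by positivity
  have hwx : ‖w‖ = x := by
    rw [hw, norm_mul, norm_inv, Complex.norm_real, Real.norm_of_nonneg (by positivity)]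
  have hb := summable_thetaR hq0 hq1 hx0
  have hna : ∀ j : ℤ, ‖((q ^ ((j : ℝ) ^ 2 / 2) : ℝ) : ℂ) * w ^ j‖ =
      q ^ ((j : ℝ) ^ 2 / 2) * x ^ j := fun j => by
    rw [norm_mul, norm_zpow, hwx, Complex.norm_real, Real.norm_of_nonneg (by positivity)]
  have ha : Summable fun j : ℤ => ((q ^ ((j : ℝ) ^ 2 / 2) : ℝ) : ℂ) * w ^ j :=
    Summable.of_norm (by simpa only [hna] using hb)
  have hat : Summable fun j : ℤ =>
      ((q ^ ((j : ℝ) ^ 2 / 2) : ℝ) : ℂ) * w ^ j * (qTailInt q (m - j) : ℂ) := by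
    refine Summable.of_norm_bounded hb fun j => ?_
    rw [norm_mul, hna, Complex.norm_real, Real.norm_of_nonneg (qTailInt_nonneg hq0 hq1 _)]
    exact mul_le_of_le_one_right (by positivity) (qTailInt_le_one hq0 hq1 _)
  refine ⟨∑' j : ℤ, ((q ^ ((j : ℝ) ^ 2 / 2) : ℝ) : ℂ) * w ^ j * (qTailInt q (m - j) : ℂ) -
    theta w q, ?_, ?_⟩
  · rw [add_sub_cancel, ← eulerSeries_eq_tsum_int hq0 hu, ← qPochInf_mul_qTail hq0 hq1,
      qPochInfR_self, eq_div_iff]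
    · have : ((q ^ (-((m : ℝ) + lam) + 1 / 2) : ℝ) : ℂ) * u =
          ((q ^ (1 / 2 : ℝ) : ℝ) : ℂ) * (((q ^ (-((m : ℝ) + lam)) : ℝ) : ℂ) * u) := by
        rw [Real.rpow_add hq0]
        push_cast
        ring
      rw [this]
      ring
    · refine mul_ne_zero ?_ ?_
      · exact_mod_cast qTail_zero_ne_zero hq0 hq1
      · exact_mod_cast (Real.rpow_pos_of_pos hq0 _).ne'
  · set h : ℕ := m / 2 + 1 with hh
    have hmh : (m : ℝ) / 2 ≤ h := by
      have : m ≤ 2 * h := by omega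
      have : (m : ℝ) ≤ 2 * h := by exact_mod_cast this
      linarith
    set A : ℝ := q ^ ((m : ℝ) / 2) with hA
    set D : ℝ := q ^ ((m : ℝ) ^ 2 / 8) / ‖u‖ ^ h with hD
    have hA0 : 0 < A := by positivity
    have hD0 : 0 < D := by positivity
    have hDh : q ^ ((h : ℝ) ^ 2 / 2) * x ^ h ≤ D := by
      have hxh : x ^ h ≤ (‖u‖ ^ h)⁻¹ := by
        rw [← inv_pow]
        gcongr
        exact mul_le_of_le_one_right (by positivity)
          (Real.rpow_le_one hq0.le hq1.le hlam.1)
      rw [hD, div_eq_mul_inv]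
      refine mul_le_mul (Real.rpow_le_rpow_of_exponent_ge hq0 hq1.le ?_) hxh
        (by positivity) (by positivity)
      nlinarith [Nat.cast_nonneg (α := ℝ) m]
    have hsh : HasSum (fun j : ℤ => q ^ (((j - h : ℤ) : ℝ) ^ 2 / 2) * x ^ (j - h))
        (thetaR x q) := ((Equiv.subRight (h : ℤ)).hasSum_iff
          (f := fun j : ℤ => q ^ ((j : ℝ) ^ 2 / 2) * x ^ j)).2 hb.hasSum
    have hbound : ‖∑' j : ℤ, ((q ^ ((j : ℝ) ^ 2 / 2) : ℝ) : ℂ) * w ^ j *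
        (qTailInt q (m - j) : ℂ) - theta w q‖ ≤
        A / (1 - q) * thetaR x q + D * thetaR x q := by
      rw [theta, ← hat.tsum_sub ha]
      refine tsum_of_norm_bounded ((hb.hasSum.mul_left (A / (1 - q))).add (hsh.mul_left D))
        fun j => ?_
      rw [← mul_sub_one, norm_mul, hna, ← Complex.ofReal_one, ← Complex.ofReal_sub,
        Complex.norm_real, Real.norm_eq_abs, abs_sub_comm,
        abs_of_nonneg (sub_nonneg.2 (qTailInt_le_one hq0 hq1 _))]
      have hbj : 0 < q ^ ((j : ℝ) ^ 2 / 2) * x ^ j := by positivity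
      have hbs : 0 < q ^ (((j - h : ℤ) : ℝ) ^ 2 / 2) * x ^ (j - h) := by positivity
      rcases lt_or_ge j h with hj | hj
      · have h2 : (m : ℝ) / 2 ≤ ((m - j : ℤ) : ℝ) := by
          have : (m : ℤ) ≤ 2 * (m - j) := by omega
          have : (m : ℝ) ≤ 2 * ((m - j : ℤ) : ℝ) := by exact_mod_cast this
          linarith
        have h3 := one_sub_qTailInt_le hq0 hq1 (n := m - j) (by omega) h2
        have h4 := mul_le_mul_of_nonneg_left h3 hbj.le
        have h5 := mul_pos hD0 hbs
        linarith
      · have h3 := qTailInt_nonneg hq0 hq1 (m - j)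
        have h4 := theta_term_le_shift hq0 hq1 hx0 h hj
        have h5 := mul_le_mul_of_nonneg_right hDh hbs.le
        have h6 : 0 < A / (1 - q) * (q ^ ((j : ℝ) ^ 2 / 2) * x ^ j) := by positivity
        nlinarith
    refine hbound.trans ?_
    have hth : 0 ≤ thetaR x q := tsum_nonneg fun j => by positivity
    have hC := one_le_tprod_one_add_pow hq0 hq1
    set C : ℝ := ∏' j : ℕ, (1 + q ^ (j + 1))
    calc A / (1 - q) * thetaR x q + D * thetaR x q
        ≤ A / (1 - q) * thetaR x q + D / (1 - q) * thetaR x q := by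
          gcongr
          rw [le_div_iff₀ h1]
          nlinarith
      _ = 1 * (thetaR x q / (1 - q) * (A + D)) := by ring
      _ ≤ (3 * C) * (thetaR x q / (1 - q) * (A + D)) := by
          gcongr
          linarith
      _ = 3 * C * thetaR x q / (1 - q) * (A + D) := by ring
end

section
/- Let 0 < q < 1 be a real number, let u be a nonzero complex number, let t > 0 be an irrational real number, and let β ∈ [0,1) be a real number. Then there exist a constant C > 0 and a positive integer N such that for every integer n ≥ N satisfying |n·t − ⌊n·t⌋ − β| ≤ 3/n, writing m = ⌊n·t⌋, one has | (q;q)_∞ · q^{m·n·t − m²/2} · u^{−m} · (−q^{−nt+1/2} u; q)_∞ − θ(u^{−1} q^{β}; q) | ≤ C · (log n) / n, where powers of q with real exponents denote real powers. -/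
/-- The coefficients `(q^{k+1};q)_∞`, extended by zero to negative `k`. -/
noncomputable def qPochTail (q : ℝ) (j : ℤ) : ℝ :=
  if 0 ≤ j then qPochInfR (q ^ (j.toNat + 1)) q else 0

theorem multipliable_one_sub_mul_pow {q : ℝ} (hq0 : 0 < q) (hq1 : q < 1) (a : ℂ) :
    Multipliable fun j : ℕ => 1 - a * (q : ℂ) ^ j := by
  simp only [sub_eq_add_neg]
  apply multipliable_one_add_of_summable
  simp only [norm_neg, norm_mul, norm_pow, Complex.norm_real, Real.norm_of_nonneg hq0.le]
  exact (summable_geometric_of_lt_one hq0.le hq1).mul_left _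

theorem multipliable_one_sub_mul_pow_real {q : ℝ} (hq0 : 0 < q) (hq1 : q < 1) (a : ℝ) :
    Multipliable fun j : ℕ => 1 - a * q ^ j := by
  simp only [sub_eq_add_neg]
  apply multipliable_one_add_of_summable
  simp only [norm_neg, norm_mul, norm_pow, Real.norm_of_nonneg hq0.le]
  exact (summable_geometric_of_lt_one hq0.le hq1).mul_left _

theorem qPochInf_eq_mul {q : ℝ} (hq0 : 0 < q) (hq1 : q < 1) (a : ℂ) :
    qPochInf a q = (1 - a) * qPochInf (a * q) q := by
  have h : ∀ j : ℕ, 1 - a * (q : ℂ) ^ (j + 1) = 1 - a * q * (q : ℂ) ^ j := fun j => by ring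
  unfold qPochInf
  rw [tprod_eq_zero_mul']
  · simp only [h, pow_zero, mul_one]
  · simp only [h]
    exact multipliable_one_sub_mul_pow hq0 hq1 _

theorem qPochInfR_eq_mul {q : ℝ} (hq0 : 0 < q) (hq1 : q < 1) (a : ℝ) :
    qPochInfR a q = (1 - a) * qPochInfR (a * q) q := by
  have h : ∀ j : ℕ, 1 - a * q ^ (j + 1) = 1 - a * q * q ^ j := fun j => by ring
  unfold qPochInfR
  rw [tprod_eq_zero_mul']
  · simp only [h, pow_zero, mul_one]
  · simp only [h]
    exact multipliable_one_sub_mul_pow_real hq0 hq1 _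

theorem one_sub_sum_le_prod_one_sub {f : ℕ → ℝ} (h0 : ∀ i, 0 ≤ f i) (h1 : ∀ i, f i ≤ 1) (n : ℕ) :
    1 - ∑ i ∈ Finset.range n, f i ≤ ∏ i ∈ Finset.range n, (1 - f i) ∧
      0 ≤ ∏ i ∈ Finset.range n, (1 - f i) ∧ ∏ i ∈ Finset.range n, (1 - f i) ≤ 1 := by
  induction n with
  | zero => simp
  | succ n ih =>
    obtain ⟨ih1, ih2, ih3⟩ := ih
    rw [Finset.sum_range_succ, Finset.prod_range_succ]
    have := h0 n
    have := h1 n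
    refine ⟨?_, ?_, ?_⟩ <;> nlinarith

theorem qPochInfR_mem_Icc {q : ℝ} (hq0 : 0 < q) (hq1 : q < 1) {a : ℝ} (ha0 : 0 ≤ a)
    (ha1 : a ≤ 1) : qPochInfR a q ∈ Set.Icc 0 1 ∧ 1 - a / (1 - q) ≤ qPochInfR a q := by
  have hlim := (multipliable_one_sub_mul_pow_real hq0 hq1 a).tendsto_prod_tprod_nat
  have hpow : ∀ i : ℕ, q ^ i ≤ 1 := fun i => pow_le_one₀ hq0.le hq1.le
  have key := one_sub_sum_le_prod_one_sub (f := fun i => a * q ^ i) (fun i => by positivity)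
    (fun i => mul_le_one₀ ha1 (by positivity) (hpow i))
  refine ⟨⟨ge_of_tendsto' hlim fun n => (key n).2.1, le_of_tendsto' hlim fun n => (key n).2.2⟩,
    ge_of_tendsto' hlim fun n => ?_⟩
  refine le_trans ?_ (key n).1
  have hg := (summable_geometric_of_lt_one hq0.le hq1).sum_le_tsum (Finset.range n)
    (fun i _ => by positivity)
  rw [tsum_geometric_of_lt_one hq0.le hq1] at hg
  rw [← Finset.mul_sum, div_eq_mul_inv]
  gcongr

theorem qPochTail_natCast (q : ℝ) (k : ℕ) : qPochTail q k = qPochInfR (q ^ (k + 1)) q := by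
  simp [qPochTail]

theorem qPochTail_mem_Icc {q : ℝ} (hq0 : 0 < q) (hq1 : q < 1) (j : ℤ) :
    qPochTail q j ∈ Set.Icc 0 1 := by
  unfold qPochTail
  split_ifs
  · exact (qPochInfR_mem_Icc hq0 hq1 (by positivity) (pow_le_one₀ hq0.le hq1.le)).1
  · simp

theorem abs_qPochTail_sub_one_le {q : ℝ} (hq0 : 0 < q) (hq1 : q < 1) (j : ℤ) :
    |qPochTail q j - 1| ≤ q ^ (j + 1) / (1 - q) := by
  have h1q : 0 < 1 - q := sub_pos.2 hq1
  have hm := qPochTail_mem_Icc hq0 hq1 j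
  rw [abs_sub_comm, abs_of_nonneg (sub_nonneg.2 hm.2)]
  by_cases hj : 0 ≤ j
  · lift j to ℕ using hj
    rw [qPochTail_natCast]
    have := (qPochInfR_mem_Icc hq0 hq1 (a := q ^ (j + 1)) (by positivity)
      (pow_le_one₀ hq0.le hq1.le)).2
    have e : q ^ ((j : ℤ) + 1) = q ^ (j + 1) := by exact_mod_cast zpow_natCast q (j + 1)
    rw [e]
    linarith
  · rw [qPochTail, if_neg hj, sub_zero, le_div_iff₀ h1q]
    have : (1 : ℝ) ≤ q ^ (j + 1) := one_le_zpow_of_nonpos₀ hq0 hq1.le (by omega)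
    linarith

theorem summable_abs_pow_mul_gaussian_mul_zpow {q : ℝ} (hq0 : 0 < q) (hq1 : q < 1) {c : ℝ}
    (hc : 0 < c) (p : ℕ) :
    Summable fun k : ℤ => (|k| ^ p : ℝ) * (q ^ ((k : ℝ) ^ 2 / 2) * c ^ k) := by
  have hL : Real.log q < 0 := Real.log_neg hq0 hq1
  have hT : 0 < -Real.log q / (2 * Real.pi) := div_pos (neg_pos.2 hL) (by positivity)
  refine (summable_pow_mul_jacobiTheta₂_term_bound (|Real.log c| / (2 * Real.pi)) hT p).of_nonneg_of_le
    (fun k => by positivity) (fun k => ?_)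
  have h : (k : ℝ) * Real.log c ≤ |(k : ℝ)| * |Real.log c| := by
    rw [← abs_mul]; exact le_abs_self _
  have e : q ^ ((k : ℝ) ^ 2 / 2) * c ^ k
      = Real.exp (Real.log q * ((k : ℝ) ^ 2 / 2) + k * Real.log c) := by
    rw [Real.exp_add, Real.rpow_def_of_pos hq0, ← Real.rpow_intCast, Real.rpow_def_of_pos hc,
      mul_comm (Real.log c)]
  rw [e]
  push_cast
  gcongr
  have : -Real.pi * (-Real.log q / (2 * Real.pi) * (k : ℝ) ^ 2
      - 2 * (|Real.log c| / (2 * Real.pi)) * |(k : ℝ)|)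
      = Real.log q * ((k : ℝ) ^ 2 / 2) + |(k : ℝ)| * |Real.log c| := by
    have := Real.pi_ne_zero
    field_simp
    ring
  rw [this]
  linarith

/-- A power series satisfying the `q`-recurrence of Euler's identity is a `q`-Pochhammer symbol. -/
theorem tsum_eq_mul_qPochInf {q : ℝ} (hq0 : 0 < q) (hq1 : q < 1) {c : ℕ → ℂ}
    (hs : ∀ a : ℂ, Summable fun k => c k * a ^ k)
    (hc : ∀ k, c (k + 1) * (1 - (q : ℂ) ^ (k + 1)) = (q : ℂ) ^ k * c k) (a : ℂ) :
    ∑' k, c k * a ^ k = c 0 * qPochInf (-a) q := by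
  have hfun : ∀ a : ℂ, ∑' k, c k * a ^ k = (1 + a) * ∑' k, c k * (a * q) ^ k := by
    intro a
    have h2 := (summable_nat_add_iff 1).2 (hs (a * q))
    have h3 := (hs (a * q)).mul_left a
    rw [add_mul, one_mul, (hs a).tsum_eq_zero_add]
    nth_rw 1 [(hs (a * q)).tsum_eq_zero_add]
    rw [← tsum_mul_left, add_assoc, ← h2.tsum_add h3]
    simp only [pow_zero]
    congr 1
    refine tsum_congr fun k => ?_
    linear_combination a ^ (k + 1) * hc k
  have hpart : ∀ n : ℕ, ∑' k, c k * a ^ k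
      = (∏ j ∈ Finset.range n, (1 - -a * (q : ℂ) ^ j)) * ∑' k, c k * (a * q ^ n) ^ k := by
    intro n
    induction n with
    | zero => simp
    | succ n ih =>
      rw [ih, hfun (a * q ^ n), Finset.prod_range_succ]
      ring_nf
  have hq : Filter.Tendsto (fun n : ℕ => (q : ℂ) ^ n) Filter.atTop (nhds 0) :=
    tendsto_pow_atTop_nhds_zero_of_norm_lt_one
      (by rwa [Complex.norm_real, Real.norm_of_nonneg hq0.le])
  have hlim : Filter.Tendsto (fun n : ℕ => ∑' k, c k * (a * q ^ n) ^ k) Filter.atTop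
      (nhds (∑' k, c k * (a * 0) ^ k)) := by
    refine tendsto_tsum_of_dominated_convergence (hs a).norm
      (fun k => ((hq.const_mul a).pow k).const_mul (c k)) (Filter.Eventually.of_forall fun n k => ?_)
    simp only [norm_mul, norm_pow, Complex.norm_real, Real.norm_of_nonneg hq0.le]
    gcongr
    exact mul_le_of_le_one_right (norm_nonneg _) (pow_le_one₀ hq0.le hq1.le)
  have hzero : ∑' k, c k * (a * 0) ^ k = c 0 := by
    rw [tsum_eq_single 0 fun k hk => by simp [hk]]
    simp
  rw [hzero] at hlim
  have hprod := (multipliable_one_sub_mul_pow hq0 hq1 (-a)).tendsto_prod_tprod_nat.mul hlim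
  rw [mul_comm (c 0)]
  exact tendsto_nhds_unique (tendsto_const_nhds.congr hpart) hprod

theorem qPochInfR_mul_qPochInf_neg {q : ℝ} (hq0 : 0 < q) (hq1 : q < 1) (a : ℂ) :
    (qPochInfR q q : ℂ) * qPochInf (-a) q
      = ∑' k : ℕ, ((q ^ ((k : ℝ) * (k - 1) / 2) * qPochTail q k : ℝ) : ℂ) * a ^ k := by
  rw [tsum_eq_mul_qPochInf hq0 hq1 (c := fun k : ℕ =>
    ((q ^ ((k : ℝ) * (k - 1) / 2) * qPochTail q k : ℝ) : ℂ))]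
  · have := qPochTail_natCast q 0
    simp_all
  · intro a
    have hb : 0 < (‖a‖ + 1) * q ^ (-1 / 2 : ℝ) := by positivity
    refine Summable.of_norm_bounded
      ((summable_abs_pow_mul_gaussian_mul_zpow hq0 hq1 hb 0).comp_injective Nat.cast_injective)
      fun k => ?_
    have hm := qPochTail_mem_Icc hq0 hq1 k
    rw [norm_mul, norm_pow, Complex.norm_real, Real.norm_of_nonneg (mul_nonneg (by positivity) hm.1)]
    simp only [Function.comp_apply, pow_zero, one_mul, zpow_natCast, mul_pow, Int.cast_natCast]
    rw [mul_left_comm, ← Real.rpow_mul_natCast hq0.le, ← Real.rpow_add hq0, mul_comm (_ ^ k)]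
    rw [show (k : ℝ) ^ 2 / 2 + -1 / 2 * k = k * (k - 1) / 2 by ring]
    gcongr
    · exact mul_le_of_le_one_right (by positivity) hm.2
    · linarith
  · intro k
    have h := qPochInfR_eq_mul hq0 hq1 (q ^ (k + 1))
    rw [← pow_succ, ← qPochTail_natCast, ← qPochTail_natCast] at h
    have e : q ^ (((k + 1 : ℕ) : ℝ) * ((k + 1 : ℕ) - 1) / 2) = q ^ k * q ^ ((k : ℝ) * (k - 1) / 2) := by
      rw [← Real.rpow_natCast q k, ← Real.rpow_add hq0]
      congr 1
      push_cast
      ring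
    rw [e]
    norm_cast
    rw [h]
    ring

theorem normalized_qPochInf_eq_tsum {q : ℝ} (hq0 : 0 < q) (hq1 : q < 1) {u : ℂ} (hu : u ≠ 0)
    (x : ℝ) (m : ℤ) :
    (qPochInfR q q : ℂ) * ((q ^ ((m : ℝ) * x - (m : ℝ) ^ 2 / 2) : ℝ) : ℂ) * u ^ (-m) *
        qPochInf (-(((q ^ (-x + 1 / 2) : ℝ) : ℂ) * u)) q
      = ∑' l : ℤ, u ^ (-l) *
        ((q ^ ((l : ℝ) ^ 2 / 2) * (q ^ ((x - m) * l) * qPochTail q (m - l)) : ℝ) : ℂ) := by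
  have hinj : Function.Injective fun k : ℕ => m - (k : ℤ) := fun a b h => by
    simp only at h; omega
  have hsupp : Function.support (fun l : ℤ => u ^ (-l) *
      ((q ^ ((l : ℝ) ^ 2 / 2) * (q ^ ((x - m) * l) * qPochTail q (m - l)) : ℝ) : ℂ))
      ⊆ Set.range fun k : ℕ => m - (k : ℤ) := by
    intro l hl
    by_contra hr
    refine hl ?_
    have : ¬ 0 ≤ m - l := fun h => hr ⟨(m - l).toNat, by simp only; omega⟩
    simp only [qPochTail, if_neg this, mul_zero, Complex.ofReal_zero]
  rw [← hinj.tsum_eq hsupp]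
  calc _ = ((q ^ ((m : ℝ) * x - (m : ℝ) ^ 2 / 2) : ℝ) : ℂ) * u ^ (-m) *
      ((qPochInfR q q : ℂ) * qPochInf (-(((q ^ (-x + 1 / 2) : ℝ) : ℂ) * u)) q) := by ring
    _ = _ := by
      rw [qPochInfR_mul_qPochInf_neg hq0 hq1, ← tsum_mul_left]
      refine tsum_congr fun k => ?_
      have e : q ^ ((m : ℝ) * x - (m : ℝ) ^ 2 / 2) * q ^ ((k : ℝ) * (k - 1) / 2)
          * (q ^ (-x + 1 / 2)) ^ k
          = q ^ (((m - k : ℤ) : ℝ) ^ 2 / 2) * q ^ ((x - m) * ((m - k : ℤ) : ℝ)) := by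
        rw [← Real.rpow_mul_natCast hq0.le, ← Real.rpow_add hq0, ← Real.rpow_add hq0,
          ← Real.rpow_add hq0]
        congr 1
        push_cast
        ring
      have e' : u ^ (-(m - (k : ℤ))) = u ^ (-m) * u ^ k := by
        rw [← zpow_natCast u k, ← zpow_add₀ hu]
        congr 1
        ring
      rw [e', sub_sub_cancel, ← mul_assoc (q ^ _) (q ^ _), ← e]
      push_cast
      ring

theorem theta_inv_mul_rpow_eq_tsum {q : ℝ} (hq0 : 0 < q) (u : ℂ) (b : ℝ) :
    theta (u⁻¹ * ((q ^ b : ℝ) : ℂ)) q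
      = ∑' l : ℤ, u ^ (-l) * ((q ^ ((l : ℝ) ^ 2 / 2) * q ^ (b * l) : ℝ) : ℂ) := by
  refine tsum_congr fun l => ?_
  rw [mul_zpow, inv_zpow', Real.rpow_mul_intCast hq0.le]
  push_cast
  ring

theorem abs_rpow_sub_rpow_le {q : ℝ} (hq0 : 0 < q) (a b : ℝ) :
    |q ^ a - q ^ b| ≤ |a - b| * |Real.log q| * (q ^ a + q ^ b) := by
  have key : ∀ x y : ℝ, Real.exp x - Real.exp y ≤ |x - y| * (Real.exp x + Real.exp y) := by
    intro x y
    have h1 := Real.add_one_le_exp (y - x)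
    have h2 : Real.exp y = Real.exp x * Real.exp (y - x) := by rw [← Real.exp_add]; ring_nf
    have h3 := le_abs_self (x - y)
    have := Real.exp_pos x
    have := mul_nonneg (abs_nonneg (x - y)) (Real.exp_pos y).le
    nlinarith
  rw [Real.rpow_def_of_pos hq0, Real.rpow_def_of_pos hq0, ← abs_mul, abs_le]
  have h1 := key (Real.log q * a) (Real.log q * b)
  have h2 := key (Real.log q * b) (Real.log q * a)
  rw [show Real.log q * a - Real.log q * b = (a - b) * Real.log q by ring] at h1
  rw [abs_sub_comm, show Real.log q * a - Real.log q * b = (a - b) * Real.log q by ring] at h2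
  constructor <;> linarith

theorem rpow_mul_intCast_le_one_add {q : ℝ} (hq0 : 0 < q) (hq1 : q < 1) {d : ℝ} (hd0 : 0 ≤ d)
    (hd1 : d ≤ 1) (l : ℤ) : q ^ (d * l) ≤ 1 + q ^ l := by
  have hpos : 0 < q ^ l := zpow_pos hq0 l
  rcases le_total 0 l with hl | hl
  · have hl' : (0 : ℝ) ≤ l := by exact_mod_cast hl
    have : q ^ (d * l) ≤ 1 := Real.rpow_le_one hq0.le hq1.le (by positivity)
    linarith
  · have hl' : (l : ℝ) ≤ 0 := by exact_mod_cast hl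
    have : q ^ (d * l) ≤ q ^ (l : ℝ) :=
      Real.rpow_le_rpow_of_exponent_ge hq0 hq1.le (by nlinarith)
    rw [Real.rpow_intCast] at this
    linarith

theorem abs_rpow_mul_qPochTail_sub_rpow_le {q : ℝ} (hq0 : 0 < q) (hq1 : q < 1) {d b : ℝ}
    (hd0 : 0 ≤ d) (hd1 : d ≤ 1) (hb0 : 0 ≤ b) (hb1 : b ≤ 1) (m l : ℤ) :
    |q ^ (d * l) * qPochTail q (m - l) - q ^ (b * l)|
      ≤ (1 + q ^ l) * (q ^ (m - l + 1) / (1 - q) + |d - b| * |Real.log q| * (2 * |(l : ℝ)|)) := by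
  have hd := rpow_mul_intCast_le_one_add hq0 hq1 hd0 hd1 l
  have hb := rpow_mul_intCast_le_one_add hq0 hq1 hb0 hb1 l
  have h1 := abs_qPochTail_sub_one_le hq0 hq1 (m - l)
  have h2 := abs_rpow_sub_rpow_le hq0 (d * l) (b * l)
  have h1q : 0 < 1 - q := sub_pos.2 hq1
  rw [← sub_mul, abs_mul] at h2
  calc _ = |q ^ (d * l) * (qPochTail q (m - l) - 1) + (q ^ (d * l) - q ^ (b * l))| := by ring_nf
    _ ≤ q ^ (d * l) * |qPochTail q (m - l) - 1| + |q ^ (d * l) - q ^ (b * l)| := by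
      refine (abs_add_le _ _).trans_eq ?_
      rw [abs_mul, abs_of_pos (Real.rpow_pos_of_pos hq0 _)]
    _ ≤ (1 + q ^ l) * (q ^ (m - l + 1) / (1 - q))
        + |d - b| * |(l : ℝ)| * |Real.log q| * ((1 + q ^ l) + (1 + q ^ l)) := by
      refine add_le_add (by gcongr) (h2.trans (by gcongr))
    _ = _ := by ring

/-- The summand dominating the error, up to the factor `1 / n`. -/
theorem summable_error_bound {q : ℝ} (hq0 : 0 < q) (hq1 : q < 1) {c : ℝ} (hc : 0 < c) (A B : ℝ) :
    Summable fun l : ℤ => c ^ (-l) * (q ^ ((l : ℝ) ^ 2 / 2) *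
      ((1 + q ^ l) * (A * q ^ (-l) + B * |(l : ℝ)|))) := by
  have s := fun {c : ℝ} (hc : 0 < c) p => summable_abs_pow_mul_gaussian_mul_zpow hq0 hq1 hc p
  have hc' : 0 < c⁻¹ := inv_pos.2 hc
  refine ((((s (div_pos hc' hq0) 0).mul_left A).add ((s hc' 0).mul_left A)).add
    (((s hc' 1).mul_left B).add ((s (mul_pos hc' hq0) 1).mul_left B))).congr fun l => ?_
  have : q ^ l ≠ 0 := (zpow_pos hq0 l).ne'
  have : c ^ l ≠ 0 := (zpow_pos hc l).ne'
  simp only [div_zpow, mul_zpow, inv_zpow, zpow_neg, pow_zero, pow_one, Int.cast_abs]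
  field_simp

theorem summable_theta_summand {q : ℝ} (hq0 : 0 < q) (hq1 : q < 1) {u : ℂ} (hu : u ≠ 0) (d : ℝ)
    {w : ℤ → ℝ} (hw : ∀ l, |w l| ≤ 1) :
    Summable fun l : ℤ => u ^ (-l) *
      ((q ^ ((l : ℝ) ^ 2 / 2) * (q ^ (d * l) * w l) : ℝ) : ℂ) := by
  have hc : 0 < ‖u‖⁻¹ * q ^ d := by have := norm_pos_iff.2 hu; positivity
  refine (summable_abs_pow_mul_gaussian_mul_zpow hq0 hq1 hc 0).of_norm_bounded fun l => ?_
  rw [norm_mul, norm_zpow, Complex.norm_real, norm_mul, norm_mul,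
    Real.norm_of_nonneg (by positivity : (0 : ℝ) ≤ q ^ ((l : ℝ) ^ 2 / 2)),
    Real.norm_of_nonneg (by positivity : (0 : ℝ) ≤ q ^ (d * l)), Real.norm_eq_abs,
    Real.rpow_mul_intCast hq0.le, mul_zpow, inv_zpow', pow_zero, one_mul]
  calc _ ≤ ‖u‖ ^ (-l) * (q ^ ((l : ℝ) ^ 2 / 2) * ((q ^ d) ^ l * 1)) := by
        gcongr
        exact hw l
    _ = _ := by ring

theorem zpow_floor_le {q : ℝ} (hq0 : 0 < q) (hq1 : q < 1) {x : ℝ} (hx : 0 < x) :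
    q ^ (⌊x⌋ + 1) ≤ 1 / (|Real.log q| * x) := by
  have hL : 0 < |Real.log q| := abs_pos.2 (Real.log_neg hq0 hq1).ne
  rw [← Real.rpow_intCast]
  push_cast
  calc q ^ ((⌊x⌋ : ℝ) + 1) ≤ q ^ x :=
        Real.rpow_le_rpow_of_exponent_ge hq0 hq1.le (Int.lt_floor_add_one x).le
    _ = 1 / Real.exp (|Real.log q| * x) := by
        rw [Real.rpow_def_of_pos hq0, abs_of_neg (Real.log_neg hq0 hq1), one_div, ← Real.exp_neg]
        ring_nf
    _ ≤ _ := by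
        gcongr
        linarith [Real.add_one_le_exp (|Real.log q| * x)]

/-- Irrational case of the main theorem: for `0 < q < 1`, nonzero complex `u`, irrational
`t > 0` and `β ∈ [0,1)`, there exist `C > 0` and `N ≥ 1` such that for every `n ≥ N` with
`|nt - ⌊nt⌋ - β| ≤ 3/n`, writing `m = ⌊nt⌋`,
`|(q;q)_∞ q^{mnt - m²/2} u^{-m} (-q^{-nt+1/2} u;q)_∞ − θ(u⁻¹ q^β;q)| ≤ C log n / n`. -/
theorem main_irrational_case (q : ℝ) (hq0 : 0 < q) (hq1 : q < 1) (u : ℂ) (hu : u ≠ 0)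
    (t : ℝ) (ht : 0 < t) (hirr : Irrational t) (beta : ℝ)
    (hbeta : beta ∈ Set.Ico (0 : ℝ) 1) :
    ∃ C : ℝ, 0 < C ∧ ∃ N : ℕ, 0 < N ∧ ∀ n : ℕ, N ≤ n →
      |(n : ℝ) * t - ⌊(n : ℝ) * t⌋ - beta| ≤ 3 / n →
      ‖((qPochInfR q q : ℝ) : ℂ) *
          ((q ^ ((⌊(n : ℝ) * t⌋ : ℝ) * (n * t) - (⌊(n : ℝ) * t⌋ : ℝ) ^ 2 / 2) : ℝ) : ℂ) *
          u ^ (-⌊(n : ℝ) * t⌋) *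
          qPochInf (-(((q ^ (-((n : ℝ) * t) + 1 / 2) : ℝ) : ℂ) * u)) q -
        theta (u⁻¹ * ((q ^ beta : ℝ) : ℂ)) q‖ ≤ C * Real.log n / n := by
  have hL : 0 < |Real.log q| := abs_pos.2 (Real.log_neg hq0 hq1).ne
  have h1q : 0 < 1 - q := sub_pos.2 hq1
  have hu' : 0 < ‖u‖ := norm_pos_iff.2 hu
  set A : ℝ := 1 / (|Real.log q| * t * (1 - q)) with hA
  set B : ℝ := 6 * |Real.log q| with hB
  have hM := summable_error_bound hq0 hq1 hu' A B
  set M : ℤ → ℝ := fun l => ‖u‖ ^ (-l) * (q ^ ((l : ℝ) ^ 2 / 2) *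
      ((1 + q ^ l) * (A * q ^ (-l) + B * |(l : ℝ)|))) with hMdef
  have hM0 : 0 ≤ ∑' l, M l := tsum_nonneg fun l => by positivity
  refine ⟨∑' l, M l + 1, by linarith, 3, by norm_num, fun n hn hclose => ?_⟩
  have hn3 : (3 : ℝ) ≤ n := by exact_mod_cast hn
  have hn0 : (0 : ℝ) < n := by linarith
  have hlog : 1 ≤ Real.log n := by
    rw [Real.le_log_iff_exp_le hn0]
    linarith [Real.exp_one_lt_d9]
  have hfloor := zpow_floor_le hq0 hq1 (mul_pos hn0 ht)
  have hd0 : 0 ≤ (n : ℝ) * t - ⌊(n : ℝ) * t⌋ := sub_nonneg.2 (Int.floor_le _)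
  have hd1 : (n : ℝ) * t - ⌊(n : ℝ) * t⌋ ≤ 1 := by linarith [Int.lt_floor_add_one ((n : ℝ) * t)]
  rw [normalized_qPochInf_eq_tsum hq0 hq1 hu, theta_inv_mul_rpow_eq_tsum hq0]
  set m := ⌊(n : ℝ) * t⌋
  have hs1 := summable_theta_summand hq0 hq1 hu (n * t - m) (w := fun l => qPochTail q (m - l))
    fun l => by
      have := qPochTail_mem_Icc hq0 hq1 (m - l)
      rw [abs_of_nonneg this.1]
      exact this.2
  have hs2 := summable_theta_summand hq0 hq1 hu beta (w := fun _ => 1) (by simp)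
  simp only [mul_one] at hs2
  rw [← hs1.tsum_sub hs2]
  have hbound : ‖∑' l : ℤ, (u ^ (-l) *
      ((q ^ ((l : ℝ) ^ 2 / 2) * (q ^ ((n * t - m) * l) * qPochTail q (m - l)) : ℝ) : ℂ)
      - u ^ (-l) * ((q ^ ((l : ℝ) ^ 2 / 2) * q ^ (beta * l) : ℝ) : ℂ))‖
      ≤ (∑' l, M l) * (1 / n) := by
    refine tsum_of_norm_bounded (hM.hasSum.mul_right _) fun l => ?_
    rw [← mul_sub, ← Complex.ofReal_sub, ← mul_sub, norm_mul, norm_zpow, Complex.norm_real, norm_mul,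
      Real.norm_of_nonneg (by positivity : (0 : ℝ) ≤ q ^ ((l : ℝ) ^ 2 / 2)), Real.norm_eq_abs]
    calc _ ≤ ‖u‖ ^ (-l) * (q ^ ((l : ℝ) ^ 2 / 2) * ((1 + q ^ l) *
          (q ^ (m - l + 1) / (1 - q)
            + |n * t - m - beta| * |Real.log q| * (2 * |(l : ℝ)|)))) := by
          gcongr
          exact abs_rpow_mul_qPochTail_sub_rpow_le hq0 hq1 hd0 hd1 hbeta.1 hbeta.2.le m l
      _ ≤ ‖u‖ ^ (-l) * (q ^ ((l : ℝ) ^ 2 / 2) * ((1 + q ^ l) *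
          (1 / (|Real.log q| * (n * t)) * q ^ (-l) / (1 - q)
            + 3 / n * |Real.log q| * (2 * |(l : ℝ)|)))) := by
          rw [show m - l + 1 = (m + 1) + -l by ring, zpow_add₀ hq0.ne']
          gcongr
      _ = _ := by
          simp only [hMdef, hA, hB]
          field_simp
          ring
  refine hbound.trans ?_
  rw [mul_one_div]
  gcongr
  nlinarith
end
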